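/- Let α, β, γ be Lipschitz integers and let δ be their vector product, i.e. a Lipschitz integer such that for every x : Quaternion ℤ, (δ * star x).re equals the determinant of the 4×4 integer matrix whose rows are the coordinate vectors ![re, imI, imJ, imK] of α, β, γ, x, in this order. Then N(δ) = N(α)N(β)N(γ) − N(α)(β·γ)² − N(β)(α·γ)² − N(γ)(α·β)² + 2(α·β)(α·γ)(β·γ), where u·v := (u * star v).re and N(u) := Quaternion.normSq u. -/

import Mathlib

/-- The coordinate vector of a Lipschitz integer. -/
def coords (q : Quaternion ℤ) : Fin 4 → ℤ := ![q.re, q.imI, q.imJ, q.imK]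

theorem re_mul_star_eq_sum (u v : Quaternion ℤ) :
    (u * star v).re = u.re * v.re + u.imI * v.imI + u.imJ * v.imJ + u.imK * v.imK := by
  simp only [Quaternion.re_mul, Quaternion.re_star, Quaternion.imI_star, Quaternion.imJ_star,
    Quaternion.imK_star]
  ring

theorem normSq_vectorProduct_formula (α β γ δ : Quaternion ℤ)
    (hδ : ∀ x : Quaternion ℤ,
      (δ * star x).re = (Matrix.of ![coords α, coords β, coords γ, coords x]).det) :
    Quaternion.normSq δ =
      Quaternion.normSq α * Quaternion.normSq β * Quaternion.normSq γ
        - Quaternion.normSq α * ((β * star γ).re) ^ 2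
        - Quaternion.normSq β * ((α * star γ).re) ^ 2
        - Quaternion.normSq γ * ((α * star β).re) ^ 2
        + 2 * ((α * star β).re) * ((α * star γ).re) * ((β * star γ).re) := by
  simp only [re_mul_star_eq_sum] at hδ ⊢
  have hre := hδ ⟨1, 0, 0, 0⟩
  have hI := hδ ⟨0, 1, 0, 0⟩
  have hJ := hδ ⟨0, 0, 1, 0⟩
  have hK := hδ ⟨0, 0, 0, 1⟩
  simp [coords, Matrix.det_succ_row_zero, Fin.sum_univ_succ, Fin.succAbove] at hre hI hJ hK
  simp only [Quaternion.normSq_def', hre, hI, hJ, hK]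
  ring
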